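/- The map φ : X → M_1(ℝ) is injective: if x, y ∈ X and φ(x) = φ(y), then x = y. In particular, the second moment of φ(x) equals x_0 (i.e. ∫ λ² dφ(x)(λ) = x_0), and the positive entries x_1 ≥ x_2 ≥ ⋯ are determined recursively from the zeros of the characteristic function of φ(x). -/

import Mathlib

open MeasureTheory BoundedContinuousFunction Filter

noncomputable section

/-- Membership in the space `X ⊆ l^∞`: `x_j ≥ x_{j+1} ≥ 0` for `j ≥ 1` and
`Σ_{j=1}^∞ x_j² ≤ x_0` (the series being summable). Bounded sequences are modeled as
bounded (continuous) functions `ℕ →ᵇ ℝ`, whose distance is the sup metric `d`. -/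
def memX (x : ℕ →ᵇ ℝ) : Prop :=
  (∀ j : ℕ, 1 ≤ j → 0 ≤ x (j + 1) ∧ x (j + 1) ≤ x j) ∧
  Summable (fun j : ℕ => (x (j + 1)) ^ 2) ∧ (∑' j : ℕ, (x (j + 1)) ^ 2) ≤ x 0

def setX : Set (ℕ →ᵇ ℝ) := {x | memX x}

/-- `J(x) = x_0 − Σ_{j=1}^∞ x_j²`. -/
def Jfun (x : ℕ →ᵇ ℝ) : ℝ := x 0 - ∑' j : ℕ, (x (j + 1)) ^ 2

/-- The rate function `I(x) = x_0 − 1 − ln J(x)` for `J(x) > 0`, and `+∞` when `J(x) = 0`. -/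
def Ifun (x : ℕ →ᵇ ℝ) : EReal :=
  if 0 < Jfun x then ((x 0 - 1 - Real.log (Jfun x) : ℝ) : EReal) else ⊤

open Topology

/-- Gaussian domination of the cosine near the origin. -/
lemma cos_le_exp_neg_sq_div_two {u : ℝ} (hu : |u| ≤ 1) :
    Real.cos u ≤ Real.exp (-(u ^ 2 / 2)) := by
  have hcos := (abs_le.1 (Real.cos_bound hu)).2
  have hsq : u ^ 2 ≤ 1 := (sq_le_one_iff_abs_le_one u).2 hu
  have hv : |-(u ^ 2 / 2)| ≤ 1 := by
    rw [abs_neg, abs_of_nonneg (by positivity)]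
    linarith
  have hexp := (abs_le.1 (Real.exp_bound hv (n := 3) (by norm_num))).1
  rw [abs_neg, abs_of_nonneg (by positivity : (0 : ℝ) ≤ u ^ 2 / 2)] at hexp
  have habs : |u| ^ 4 = (u ^ 2) ^ 2 := by
    rw [← sq_abs u]
    ring
  rw [habs] at hcos
  norm_num [Finset.sum_range_succ, Nat.factorial] at hexp
  nlinarith [mul_nonneg (sq_nonneg (u ^ 2)) (sub_nonneg.2 hsq), sq_nonneg (u ^ 2)]

/-- The Weierstrass product inequality. -/
lemma one_sub_sum_one_sub_le_prod {ι : Type*} (F : Finset ι) {f : ι → ℝ}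
    (h0 : ∀ i, 0 ≤ f i) (h1 : ∀ i, f i ≤ 1) :
    1 - ∑ i ∈ F, (1 - f i) ≤ ∏ i ∈ F, f i := by
  classical
  induction F using Finset.induction_on with
  | empty => simp
  | insert i F hi ih =>
    rw [Finset.sum_insert hi, Finset.prod_insert hi]
    have hle : ∏ j ∈ F, f j ≤ 1 := Finset.prod_le_one (fun j _ => h0 j) (fun j _ => h1 j)
    nlinarith [h0 i, h1 i, mul_nonneg (sub_nonneg.2 (h1 i)) (sub_nonneg.2 hle)]

section CosProduct

variable {a : ℕ → ℝ}

lemma summable_cos_sub_one (ha : Summable fun j => a j ^ 2) (s : ℝ) :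
    Summable fun j => Real.cos (s * a j) - 1 := by
  refine Summable.of_norm_bounded (g := fun j => s ^ 2 / 2 * a j ^ 2) (ha.mul_left _) fun j => ?_
  rw [Real.norm_eq_abs, abs_of_nonpos (by linarith [Real.cos_le_one (s * a j)])]
  nlinarith [Real.one_sub_sq_div_two_le_cos (x := s * a j)]

lemma multipliable_cos_mul (ha : Summable fun j => a j ^ 2) (s : ℝ) :
    Multipliable fun j => Real.cos (s * a j) := by
  have h := multipliable_one_add_of_summable (summable_cos_sub_one ha s).norm
  simpa using h

lemma tprod_cos_mul_pos (ha : Summable fun j => a j ^ 2) {s : ℝ}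
    (hpos : ∀ j, 0 < Real.cos (s * a j)) : 0 < ∏' j, Real.cos (s * a j) := by
  have h := Real.summable_log_one_add_of_summable (summable_cos_sub_one ha s)
  rw [← Real.rexp_tsum_eq_tprod hpos (by simpa using h)]
  exact Real.exp_pos _

lemma abs_tprod_cos_mul_le_one (ha : Summable fun j => a j ^ 2) (s : ℝ) :
    |∏' j, Real.cos (s * a j)| ≤ 1 := by
  refine le_of_tendsto (multipliable_cos_mul ha s).hasProd.abs (.of_forall fun F => ?_)
  exact Finset.prod_le_one (fun _ _ => abs_nonneg _) (fun _ _ => Real.abs_cos_le_one _)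

lemma tprod_cos_mul_le_of_le (ha : Summable fun j => a j ^ 2) (ha0 : ∀ j, 0 ≤ a j) {s t : ℝ}
    (hs : 0 ≤ s) (hst : s ≤ t) (ht : ∀ j, t * a j ≤ Real.pi / 2) :
    ∏' j, Real.cos (t * a j) ≤ ∏' j, Real.cos (s * a j) := by
  refine le_of_tendsto_of_tendsto (multipliable_cos_mul ha t).hasProd
    (multipliable_cos_mul ha s).hasProd (.of_forall fun F => ?_)
  refine Finset.prod_le_prod (fun j _ => ?_) (fun j _ => ?_)
  · exact Real.cos_nonneg_of_neg_pi_div_two_le_of_le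
      (by linarith [Real.pi_pos, mul_nonneg (hs.trans hst) (ha0 j)]) (ht j)
  · exact Real.cos_le_cos_of_nonneg_of_le_pi (mul_nonneg hs (ha0 j))
      (by linarith [Real.pi_pos, ht j]) (mul_le_mul_of_nonneg_right hst (ha0 j))

lemma one_sub_le_tprod_cos_mul (ha : Summable fun j => a j ^ 2) {s : ℝ}
    (hs : ∀ j, |s * a j| ≤ 1) :
    1 - s ^ 2 * (∑' j, a j ^ 2) / 2 ≤ ∏' j, Real.cos (s * a j) := by
  refine ge_of_tendsto (multipliable_cos_mul ha s).hasProd (.of_forall fun F => ?_)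
  refine le_trans ?_ (one_sub_sum_one_sub_le_prod F (fun j => ?_) fun j => Real.cos_le_one _)
  · have hsum : ∑ j ∈ F, (1 - Real.cos (s * a j)) ≤ ∑ j ∈ F, s ^ 2 / 2 * a j ^ 2 :=
      Finset.sum_le_sum fun j _ => by
        nlinarith [Real.one_sub_sq_div_two_le_cos (x := s * a j)]
    rw [← Finset.mul_sum] at hsum
    have hle := ha.sum_le_tsum F fun j _ => sq_nonneg (a j)
    nlinarith [mul_le_mul_of_nonneg_left hle (by positivity : 0 ≤ s ^ 2 / 2)]
  · exact (Real.cos_pos_of_le_one (hs j)).le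

lemma tprod_cos_mul_le_exp (ha : Summable fun j => a j ^ 2) {s : ℝ}
    (hs : ∀ j, |s * a j| ≤ 1) :
    ∏' j, Real.cos (s * a j) ≤ Real.exp (-(s ^ 2 * (∑' j, a j ^ 2) / 2)) := by
  have hlim : Tendsto (fun F : Finset ℕ => Real.exp (-(s ^ 2 * (∑ j ∈ F, a j ^ 2) / 2))) atTop
      (𝓝 (Real.exp (-(s ^ 2 * (∑' j, a j ^ 2) / 2)))) :=
    (Real.continuous_exp.tendsto _).comp
      (((ha.hasSum : Tendsto _ _ _).const_mul (s ^ 2)).div_const 2).neg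
  refine le_of_tendsto_of_tendsto (multipliable_cos_mul ha s).hasProd hlim
    (.of_forall fun F => ?_)
  calc ∏ j ∈ F, Real.cos (s * a j) ≤ ∏ j ∈ F, Real.exp (-((s * a j) ^ 2 / 2)) :=
        Finset.prod_le_prod (fun j _ => (Real.cos_pos_of_le_one (hs j)).le)
          fun j _ => cos_le_exp_neg_sq_div_two (hs j)
    _ = Real.exp (-(s ^ 2 * (∑ j ∈ F, a j ^ 2) / 2)) := by
        rw [← Real.exp_sum, Finset.sum_neg_distrib, ← Finset.sum_div, Finset.mul_sum]
        simp only [mul_pow]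

end CosProduct

lemma eventually_cos_mul_ne_zero {c : ℝ} (hc : c ≠ 0) (s₀ : ℝ) :
    ∀ᶠ s in 𝓝[≠] s₀, Real.cos (s * c) ≠ 0 := by
  by_cases h : Real.cos (s₀ * c) = 0
  · have hd : HasDerivAt (fun s => Real.cos (s * c)) (-Real.sin (s₀ * c) * c) s₀ := by
      simpa using ((hasDerivAt_id s₀).mul_const c).cos
    refine hd.eventually_ne (mul_ne_zero (neg_ne_zero.2 fun hsin => ?_) hc)
    have := Real.sin_sq_add_cos_sq (s₀ * c)
    simp [h, hsin] at this
  · have hcont : Continuous fun s => Real.cos (s * c) := by fun_prop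
    exact (hcont.continuousAt.eventually_ne h).filter_mono nhdsWithin_le_nhds

/-- If two Gaussian–Rademacher transforms agree and their first `n` frequencies coincide, the
`n`-th frequencies are comparable: the smaller one cannot produce the zero at `π / (2 a n)`. -/
lemma le_of_exp_mul_tprod_cos_eq {a b : ℕ → ℝ} {A B : ℝ} (hanti : Antitone a) (hbnti : Antitone b)
    (hb0 : ∀ j, 0 ≤ b j) (ha : Summable fun j => a j ^ 2) (hb : Summable fun j => b j ^ 2)
    (heq : ∀ s : ℝ, Real.exp (-A * s ^ 2 / 2) * ∏' j, Real.cos (s * a j)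
      = Real.exp (-B * s ^ 2 / 2) * ∏' j, Real.cos (s * b j))
    (n : ℕ) (hn : ∀ i < n, a i = b i) : a n ≤ b n := by
  by_contra! hlt
  have han : 0 < a n := (hb0 n).trans_lt hlt
  obtain ⟨s₀, hs₀pos, hs₀a⟩ : ∃ s₀ : ℝ, 0 < s₀ ∧ s₀ * a n = Real.pi / 2 :=
    ⟨Real.pi / 2 / a n, by positivity, div_mul_cancel₀ _ han.ne'⟩
  have hbn : Summable fun j => b (j + n) ^ 2 := hb.comp_injective (add_left_injective n)
  have han1 : Summable fun j => a (j + (n + 1)) ^ 2 :=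
    ha.comp_injective (add_left_injective (n + 1))
  have htail : ∀ j, s₀ * b (j + n) < Real.pi / 2 := fun j => by
    rw [← hs₀a]
    exact mul_lt_mul_of_pos_left ((hbnti (Nat.le_add_left n j)).trans_lt hlt) hs₀pos
  obtain ⟨c, hc⟩ : ∃ c, c = ∏' j, Real.cos (s₀ * b (j + n)) := ⟨_, rfl⟩
  have hcpos : 0 < c := hc ▸ tprod_cos_mul_pos hbn fun j => Real.cos_pos_of_mem_Ioo
    ⟨by linarith [Real.pi_pos, mul_nonneg hs₀pos.le (hb0 (j + n))], htail j⟩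
  have hne : ∀ᶠ s in 𝓝[<] s₀, ∏ i ∈ Finset.range n, Real.cos (s * a i) ≠ 0 := by
    simp only [Finset.prod_ne_zero_iff]
    refine (Filter.eventually_all_finset _).2 fun i hi => ?_
    refine (eventually_cos_mul_ne_zero ?_ s₀).filter_mono
      (nhdsWithin_mono _ fun s hs => ne_of_lt hs)
    exact (han.trans_le (hanti (Finset.mem_range.1 hi).le)).ne'
  have hpos : ∀ᶠ s in 𝓝[<] s₀, 0 < s :=
    (eventually_gt_nhds hs₀pos).filter_mono nhdsWithin_le_nhds
  have hbound : ∀ᶠ s in 𝓝[<] s₀, Real.exp (-B * s ^ 2 / 2) * c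
      ≤ Real.exp (-A * s ^ 2 / 2) * |Real.cos (s * a n)| := by
    filter_upwards [hne, hpos, self_mem_nhdsWithin] with s hs hs0 hlt'
    have hfac := heq s
    have hhead : ∏ i ∈ Finset.range n, Real.cos (s * a i)
        = ∏ i ∈ Finset.range n, Real.cos (s * b i) :=
      Finset.prod_congr rfl fun i hi => by rw [hn i (Finset.mem_range.1 hi)]
    rw [← (multipliable_cos_mul han1 s).prod_mul_tprod_nat_mul' (f := fun j => Real.cos (s * a j)),
      ← (multipliable_cos_mul hbn s).prod_mul_tprod_nat_mul' (f := fun j => Real.cos (s * b j)),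
      Finset.prod_range_succ, ← hhead] at hfac
    have hcancel : Real.exp (-A * s ^ 2 / 2) *
        (Real.cos (s * a n) * ∏' j, Real.cos (s * a (j + (n + 1))))
        = Real.exp (-B * s ^ 2 / 2) * ∏' j, Real.cos (s * b (j + n)) := by
      apply mul_left_cancel₀ hs
      linear_combination hfac
    have hcle : c ≤ ∏' j, Real.cos (s * b (j + n)) :=
      hc ▸ tprod_cos_mul_le_of_le hbn (fun j => hb0 _) hs0.le (le_of_lt hlt') fun j => (htail j).le
    calc Real.exp (-B * s ^ 2 / 2) * c
        ≤ Real.exp (-B * s ^ 2 / 2) * ∏' j, Real.cos (s * b (j + n)) := by gcongr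
      _ = Real.exp (-A * s ^ 2 / 2) *
            (Real.cos (s * a n) * ∏' j, Real.cos (s * a (j + (n + 1)))) := hcancel.symm
      _ ≤ Real.exp (-A * s ^ 2 / 2) * |Real.cos (s * a n)| := by
        gcongr
        refine (le_abs_self _).trans ?_
        rw [abs_mul]
        exact mul_le_of_le_one_right (abs_nonneg _) (abs_tprod_cos_mul_le_one han1 s)
  have hl : Continuous fun s : ℝ => Real.exp (-B * s ^ 2 / 2) * c := by fun_prop
  have hr : Continuous fun s : ℝ => Real.exp (-A * s ^ 2 / 2) * |Real.cos (s * a n)| := by fun_prop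
  have hlim := le_of_tendsto_of_tendsto ((hl.tendsto s₀).mono_left nhdsWithin_le_nhds)
    ((hr.tendsto s₀).mono_left nhdsWithin_le_nhds) hbound
  rw [hs₀a, Real.cos_pi_div_two, abs_zero, mul_zero] at hlim
  exact absurd hlim (not_le.2 (by positivity))

/-- A probability measure whose real characteristic function is pinched between the second-order
Taylor polynomial and the Gaussian of variance `v` near the origin has second moment `v`. -/
lemma integral_sq_eq_of_integral_cos_bounds (μ : Measure ℝ) [IsProbabilityMeasure μ] (v : ℝ)
    (hlow : ∀ᶠ s : ℝ in 𝓝[>] 0, 1 - s ^ 2 * v / 2 ≤ ∫ t, Real.cos (s * t) ∂μ)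
    (hupp : ∀ᶠ s : ℝ in 𝓝[>] 0, ∫ t, Real.cos (s * t) ∂μ ≤ Real.exp (-(s ^ 2 * v / 2)))
    (hv : 0 ≤ v) : ∫ t, t ^ 2 ∂μ = v := by
  have hcosint (s : ℝ) : Integrable (fun t => Real.cos (s * t)) μ :=
    Integrable.of_bound (by fun_prop) 1 (.of_forall fun t => by
      simpa using Real.abs_cos_le_one (s * t))
  have hint (s : ℝ) : Integrable (fun t => 2 / s ^ 2 * (1 - Real.cos (s * t))) μ :=
    ((integrable_const 1).sub (hcosint s)).const_mul _
  have hval (s : ℝ) : ∫ t, 2 / s ^ 2 * (1 - Real.cos (s * t)) ∂μ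
      = 2 / s ^ 2 * (1 - ∫ t, Real.cos (s * t) ∂μ) := by
    rw [integral_const_mul, integral_sub (integrable_const 1) (hcosint s)]
    simp
  have hnn (s t : ℝ) : 0 ≤ 2 / s ^ 2 * (1 - Real.cos (s * t)) :=
    mul_nonneg (by positivity) (sub_nonneg.2 (Real.cos_le_one _))
  have hle (s t : ℝ) (hs : 0 < s) : 2 / s ^ 2 * (1 - Real.cos (s * t)) ≤ t ^ 2 := by
    rw [div_mul_eq_mul_div, div_le_iff₀ (by positivity)]
    nlinarith [Real.one_sub_sq_div_two_le_cos (x := s * t)]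
  have hpt (t : ℝ) : Tendsto (fun s => 2 / s ^ 2 * (1 - Real.cos (s * t))) (𝓝[>] 0)
      (𝓝 (t ^ 2)) := by
    have hcont : Continuous fun s : ℝ => t ^ 2 * Real.sinc (s * t / 2) ^ 2 := by fun_prop
    have hlim := (hcont.tendsto 0).mono_left (nhdsWithin_le_nhds (s := Set.Ioi 0))
    simp only [zero_mul, zero_div, Real.sinc_zero, one_pow, mul_one] at hlim
    refine hlim.congr' ?_
    filter_upwards [self_mem_nhdsWithin] with s hs
    have hs0 : s ≠ 0 := ne_of_gt hs
    rcases eq_or_ne t 0 with rfl | ht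
    · simp
    · have hcos : Real.cos (s * t) = 1 - 2 * Real.sin (s * t / 2) ^ 2 := by
        rw [Real.sin_sq_eq_half_sub]
        ring_nf
      rw [Real.sinc_of_ne_zero (by positivity), hcos]
      field_simp
      ring
  have hfatou : ∫⁻ t, ENNReal.ofReal (t ^ 2) ∂μ ≤ ENNReal.ofReal v := by
    calc ∫⁻ t, ENNReal.ofReal (t ^ 2) ∂μ
        = ∫⁻ t, liminf (fun s => ENNReal.ofReal (2 / s ^ 2 * (1 - Real.cos (s * t))))
            (𝓝[>] (0 : ℝ)) ∂μ :=
          lintegral_congr fun t => ((ENNReal.tendsto_ofReal (hpt t)).liminf_eq).symm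
      _ ≤ liminf (fun s => ∫⁻ t, ENNReal.ofReal (2 / s ^ 2 * (1 - Real.cos (s * t))) ∂μ)
            (𝓝[>] (0 : ℝ)) := lintegral_liminf_le fun s => by fun_prop
      _ ≤ ENNReal.ofReal v := by
          refine Filter.liminf_le_of_frequently_le' (Eventually.frequently ?_)
          filter_upwards [hlow, self_mem_nhdsWithin] with s hs hs0
          rw [← ofReal_integral_eq_lintegral_ofReal (hint s) (.of_forall (hnn s)), hval]
          refine ENNReal.ofReal_le_ofReal ?_
          have : 0 < s := hs0
          rw [div_mul_eq_mul_div, div_le_iff₀ (by positivity)]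
          linarith
  have hsq : Integrable (fun t : ℝ => t ^ 2) μ := by
    refine ⟨by fun_prop, ?_⟩
    rw [hasFiniteIntegral_iff_ofReal (.of_forall fun t => sq_nonneg t)]
    exact hfatou.trans_lt ENNReal.ofReal_lt_top
  refine le_antisymm ?_ ?_
  · rw [← ofReal_integral_eq_lintegral_ofReal hsq (.of_forall fun t => sq_nonneg t)] at hfatou
    exact (ENNReal.ofReal_le_ofReal_iff hv).1 hfatou
  · have hlim : Tendsto (fun s : ℝ => v / (1 + s ^ 2 * v / 2)) (𝓝[>] 0) (𝓝 v) := by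
      have hcont : ContinuousAt (fun s : ℝ => v / (1 + s ^ 2 * v / 2)) 0 :=
        continuousAt_const.div (by fun_prop) (by simp)
      have h := hcont.tendsto.mono_left (nhdsWithin_le_nhds (s := Set.Ioi 0))
      simpa using h
    refine le_of_tendsto hlim ?_
    filter_upwards [hupp, self_mem_nhdsWithin] with s hs hs0
    have hspos : 0 < s := hs0
    refine le_trans ?_ (integral_mono (hint s) hsq fun t => hle s t hspos)
    have hexp : Real.exp (-(s ^ 2 * v / 2)) ≤ 1 / (1 + s ^ 2 * v / 2) := by
      rw [Real.exp_neg, ← one_div]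
      exact one_div_le_one_div_of_le (by positivity)
        (by linarith [Real.add_one_le_exp (s ^ 2 * v / 2)])
    calc v / (1 + s ^ 2 * v / 2) = 2 / s ^ 2 * (1 - 1 / (1 + s ^ 2 * v / 2)) := by
          have : 1 + s ^ 2 * v / 2 ≠ 0 := by positivity
          field_simp
          ring
      _ ≤ 2 / s ^ 2 * (1 - ∫ t, Real.cos (s * t) ∂μ) := by
          have := hs.trans hexp
          gcongr
      _ = _ := (hval s).symm

section MemX

variable {x : ℕ →ᵇ ℝ}

lemma memX.antitone_succ (hx : memX x) : Antitone fun j => x (j + 1) :=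
  antitone_nat_of_succ_le fun j => (hx.1 (j + 1) (Nat.le_add_left 1 j)).2

lemma memX.nonneg_succ (hx : memX x) (j : ℕ) : 0 ≤ x (j + 1) :=
  (hx.1 (j + 1) (Nat.le_add_left 1 j)).1.trans (hx.antitone_succ (Nat.le_succ j))

lemma memX.Jfun_nonneg (hx : memX x) : 0 ≤ Jfun x := sub_nonneg.2 hx.2.2

lemma memX.nonneg_zero (hx : memX x) : 0 ≤ x 0 :=
  (tsum_nonneg fun _ => sq_nonneg _).trans hx.2.2

lemma memX.eventually_abs_mul_le_one (hx : memX x) :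
    ∀ᶠ s : ℝ in 𝓝[>] 0, ∀ j, |s * x (j + 1)| ≤ 1 := by
  have hcont : Continuous fun s : ℝ => s * x 1 := by fun_prop
  have hev : ∀ᶠ s : ℝ in 𝓝[>] 0, s * x 1 < 1 :=
    ((hcont.tendsto 0).eventually_lt_const (by simp)).filter_mono nhdsWithin_le_nhds
  filter_upwards [hev, self_mem_nhdsWithin] with s hs hs0 j
  have hspos : 0 < s := hs0
  rw [abs_of_nonneg (mul_nonneg hspos.le (hx.nonneg_succ j))]
  exact (mul_le_mul_of_nonneg_left (hx.antitone_succ (Nat.zero_le j)) hspos.le).trans hs.le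

end MemX

lemma eq_of_transform_eq {x y : ℕ →ᵇ ℝ} (hx : memX x) (hy : memX y)
    (heq : ∀ s : ℝ, Real.exp (-Jfun x * s ^ 2 / 2) * ∏' j : ℕ, Real.cos (s * x (j + 1))
      = Real.exp (-Jfun y * s ^ 2 / 2) * ∏' j : ℕ, Real.cos (s * y (j + 1))) (j : ℕ) :
    x (j + 1) = y (j + 1) := by
  induction j using Nat.strong_induction_on with
  | _ n ih =>
    exact le_antisymm
      (le_of_exp_mul_tprod_cos_eq hx.antitone_succ hy.antitone_succ hy.nonneg_succ
        hx.2.1 hy.2.1 heq n ih)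
      (le_of_exp_mul_tprod_cos_eq hy.antitone_succ hx.antitone_succ hx.nonneg_succ
        hy.2.1 hx.2.1 (fun s => (heq s).symm) n fun i hi => (ih i hi).symm)

lemma integral_cos_eq_re_integral_exp (μ : Measure ℝ) [IsFiniteMeasure μ] (s : ℝ) :
    ∫ t, Real.cos (s * t) ∂μ
      = (∫ t : ℝ, Complex.exp (Complex.I * (s : ℂ) * (t : ℂ)) ∂μ).re := by
  have hexp (t : ℝ) : Complex.I * (s : ℂ) * (t : ℂ) = ((s * t : ℝ) : ℂ) * Complex.I := by
    push_cast
    ring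
  have hint : Integrable (fun t : ℝ => Complex.exp (Complex.I * (s : ℂ) * (t : ℂ))) μ :=
    Integrable.of_bound (by fun_prop) 1 (.of_forall fun t => by
      rw [hexp, Complex.norm_exp_ofReal_mul_I])
  have hre := integral_re hint
  simp only [RCLike.re_eq_complex_re] at hre
  rw [← hre]
  refine integral_congr_ae (.of_forall fun t => ?_)
  simp only [hexp, Complex.exp_ofReal_mul_I_re]

/-- `φ : X → M_1(ℝ)` is injective, where `φ(x)` is characterized by its Fourier transform
`s ↦ e^{−J(x)s²/2} ∏_{j=1}^∞ cos(s x_j)`; in particular the second moment of `φ(x)`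
equals `x_0`. -/
theorem stmt19 (φ : (ℕ →ᵇ ℝ) → ProbabilityMeasure ℝ)
    (hφ : ∀ x ∈ setX, ∀ s : ℝ,
      ∫ t : ℝ, Complex.exp (Complex.I * (s : ℂ) * (t : ℂ)) ∂(φ x : Measure ℝ)
        = ((Real.exp (-(Jfun x) * s ^ 2 / 2)
            * ∏' j : ℕ, Real.cos (s * x (j + 1)) : ℝ) : ℂ)) :
    Set.InjOn φ setX ∧
    ∀ x ∈ setX, ∫ t : ℝ, t ^ 2 ∂(φ x : Measure ℝ) = x 0 := by
  have hcos : ∀ x ∈ setX, ∀ s : ℝ, ∫ t, Real.cos (s * t) ∂(φ x : Measure ℝ)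
      = Real.exp (-(Jfun x) * s ^ 2 / 2) * ∏' j : ℕ, Real.cos (s * x (j + 1)) :=
    fun x hx s => by
      rw [integral_cos_eq_re_integral_exp, hφ x hx s, Complex.ofReal_re]
  have hmoment : ∀ x ∈ setX, ∫ t : ℝ, t ^ 2 ∂(φ x : Measure ℝ) = x 0 := by
    intro x hx
    have hmem : memX x := hx
    have hJ : x 0 = Jfun x + ∑' j : ℕ, x (j + 1) ^ 2 := by simp [Jfun]
    refine integral_sq_eq_of_integral_cos_bounds _ _ ?_ ?_ hmem.nonneg_zero
    · have hcont : Continuous fun s : ℝ => s ^ 2 * (∑' j : ℕ, x (j + 1) ^ 2) / 2 := by fun_prop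
      have hev : ∀ᶠ s : ℝ in 𝓝[>] 0, s ^ 2 * (∑' j : ℕ, x (j + 1) ^ 2) / 2 < 1 :=
        ((hcont.tendsto 0).eventually_lt_const (by simp)).filter_mono nhdsWithin_le_nhds
      filter_upwards [hmem.eventually_abs_mul_le_one, hev] with s hs hsmall
      rw [hcos x hx s, hJ]
      have hprod := one_sub_le_tprod_cos_mul hmem.2.1 hs
      have hexp := Real.add_one_le_exp (-Jfun x * s ^ 2 / 2)
      have hS : 0 ≤ ∑' j : ℕ, x (j + 1) ^ 2 := tsum_nonneg fun _ => sq_nonneg _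
      have hcross : 0 ≤ (Jfun x * s ^ 2 / 2) * (s ^ 2 * (∑' j : ℕ, x (j + 1) ^ 2) / 2) := by
        have := hmem.Jfun_nonneg
        positivity
      have hfirst := mul_le_mul_of_nonneg_right hexp (sub_nonneg.2 hsmall.le)
      have hsecond := mul_le_mul_of_nonneg_left hprod (Real.exp_pos (-Jfun x * s ^ 2 / 2)).le
      linarith
    · filter_upwards [hmem.eventually_abs_mul_le_one] with s hs
      rw [hcos x hx s]
      refine (mul_le_mul_of_nonneg_left (tprod_cos_mul_le_exp hmem.2.1 hs)
        (Real.exp_pos _).le).trans_eq ?_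
      rw [← Real.exp_add, hJ]
      ring_nf
  refine ⟨fun x hx y hy hxy => ?_, hmoment⟩
  have hsucc := eq_of_transform_eq hx hy fun s => by rw [← hcos x hx s, ← hcos y hy s, hxy]
  ext j
  cases j with
  | zero => rw [← hmoment x hx, ← hmoment y hy, hxy]
  | succ j => exact hsucc j
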